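/- For every fixed t > 0 and for j = 1 and j = 2, the integrals I_{j,N}(t) converge as N → ∞ and lim_{N→∞} I_{1,N}(t) = lim_{N→∞} I_{2,N}(t) = t · I₀(2t), where I₀ is the modified Bessel function of the first kind given by its integral representation. -/

import Mathlib

open MeasureTheory Real Filter Complex

/-- Modified Bessel function of the first kind, integral representation. -/
noncomputable def besselI (n : ℕ) (x : ℝ) : ℝ :=
  (1 / (2 * Real.pi)) * ∫ θ in (0:ℝ)..(2 * Real.pi), Real.exp (x * Real.cos θ) * Real.cos (n * θ)

/-- `U_{0,N}`. -/
noncomputable def U0 (t : ℝ) (N : ℕ) (R₁ R₂ θ : ℝ) : ℂ :=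
  ((t * Real.sqrt (R₁ * R₂) : ℝ) : ℂ) *
      ((R₁ : ℂ) * Complex.exp (-(θ : ℂ) * Complex.I) + (R₂ : ℂ) * Complex.exp ((θ : ℂ) * Complex.I))
    + ((t ^ 2 / (N : ℝ) * (R₁ + R₂) : ℝ) : ℂ)

/-- `U_{1,N}`. -/
noncomputable def U1 (t : ℝ) (N : ℕ) (R₁ R₂ θ : ℝ) : ℂ :=
  ((t * ((N : ℝ) / ((N : ℝ) - 1)) * (R₁ * R₂) : ℝ) : ℂ)
    + ((t ^ 2 / ((N : ℝ) - 1) * Real.sqrt (R₁ * R₂) : ℝ) : ℂ) *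
        (Complex.exp ((θ : ℂ) * Complex.I) + Complex.exp (-(θ : ℂ) * Complex.I))
    - ((t ^ 2 / (N : ℝ) * Real.sqrt (R₁ * R₂) : ℝ) : ℂ) * Complex.exp ((θ : ℂ) * Complex.I)
    + ((t ^ 3 / ((N : ℝ) ^ 2 * ((N : ℝ) - 1)) : ℝ) : ℂ)

/-- `U_{2,N}`: as `U_{1,N}` with `e^{iθ}` replaced by `e^{−iθ}` in the third term. -/
noncomputable def U2 (t : ℝ) (N : ℕ) (R₁ R₂ θ : ℝ) : ℂ :=
  ((t * ((N : ℝ) / ((N : ℝ) - 1)) * (R₁ * R₂) : ℝ) : ℂ)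
    + ((t ^ 2 / ((N : ℝ) - 1) * Real.sqrt (R₁ * R₂) : ℝ) : ℂ) *
        (Complex.exp ((θ : ℂ) * Complex.I) + Complex.exp (-(θ : ℂ) * Complex.I))
    - ((t ^ 2 / (N : ℝ) * Real.sqrt (R₁ * R₂) : ℝ) : ℂ) * Complex.exp (-(θ : ℂ) * Complex.I)
    + ((t ^ 3 / ((N : ℝ) ^ 2 * ((N : ℝ) - 1)) : ℝ) : ℂ)

/-- The three functions `U_{j,N}`, `j = 0, 1, 2`. -/
noncomputable def Ufun (t : ℝ) (N : ℕ) : Fin 3 → ℝ → ℝ → ℝ → ℂ := ![U0 t N, U1 t N, U2 t N]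

/-- `F_{j,N}(R₁,R₂)`. -/
noncomputable def Ffun (t : ℝ) (N : ℕ) (j : Fin 3) (R₁ R₂ : ℝ) : ℂ :=
  (((R₁ * R₂) ^ 2)⁻¹ * (1 / (2 * Real.pi)) : ℝ) *
    ∫ θ in (0:ℝ)..(2 * Real.pi),
      (1 + (t : ℂ) * Complex.exp ((θ : ℂ) * Complex.I) / ((N : ℂ) * (Real.sqrt (R₁ * R₂) : ℝ))) ^ (N - 2) *
      (1 + (t : ℂ) * Complex.exp (-(θ : ℂ) * Complex.I) / ((N : ℂ) * (Real.sqrt (R₁ * R₂) : ℝ))) ^ (N - 2) *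
      Ufun t N j R₁ R₂ θ

/-- `I_{j,N}(t)`. -/
noncomputable def Ifun (t : ℝ) (N : ℕ) (j : Fin 3) : ℂ :=
  (((N : ℝ) / (2 * Real.pi) : ℝ) : ℂ) *
    ∫ R in (Set.Ioi (0:ℝ)) ×ˢ (Set.Ioi (0:ℝ)),
      ((Real.exp (-(N : ℝ) * (R.1 - 1 - Real.log R.1)) *
          Real.exp (-(N : ℝ) * (R.2 - 1 - Real.log R.2)) : ℝ) : ℂ) * Ffun t N j R.1 R.2


theorem integral_exp_int_mul_I (n : ℤ) :
    ∫ θ in (0:ℝ)..(2 * π), cexp ((n : ℂ) * I * θ) = if n = 0 then (2 * π : ℂ) else 0 := by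
  split_ifs with h
  · simp [h]
  · rw [integral_exp_mul_complex (by simp [h])]
    have : (n : ℂ) * I * ((2 * π : ℝ) : ℂ) = n * (2 * π * I) := by push_cast; ring
    rw [this, Complex.exp_int_mul_two_pi_mul_I]
    simp

theorem integral_one_add_pow_mul_one_add_pow (z : ℂ) (M : ℕ) (m : ℤ) :
    ∫ θ in (0:ℝ)..(2 * π), (1 + z * cexp (θ * I)) ^ M * (1 + z * cexp (-θ * I)) ^ M *
      cexp ((m : ℂ) * I * θ) =
    2 * π * ∑ k ∈ Finset.range (M + 1), ∑ l ∈ Finset.range (M + 1),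
      if (k : ℤ) - l + m = 0 then (M.choose k : ℂ) * M.choose l * z ^ (k + l) else 0 := by
  have h (θ : ℝ) : (1 + z * cexp (θ * I)) ^ M * (1 + z * cexp (-θ * I)) ^ M *
      cexp ((m : ℂ) * I * θ) = ∑ k ∈ Finset.range (M + 1), ∑ l ∈ Finset.range (M + 1),
        (M.choose k : ℂ) * M.choose l * z ^ (k + l) *
          cexp ((((k : ℤ) - l + m : ℤ) : ℂ) * I * θ) := by
    rw [add_comm 1, add_comm 1, add_pow, add_pow, Finset.sum_mul_sum, Finset.sum_mul]
    refine Finset.sum_congr rfl fun k _ => ?_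
    rw [Finset.sum_mul]
    refine Finset.sum_congr rfl fun l _ => ?_
    have : cexp ((((k : ℤ) - l + m : ℤ) : ℂ) * I * θ) =
        cexp (θ * I) ^ k * cexp (-θ * I) ^ l * cexp ((m : ℂ) * I * θ) := by
      rw [← Complex.exp_nat_mul, ← Complex.exp_nat_mul, ← Complex.exp_add, ← Complex.exp_add]
      push_cast
      ring_nf
    rw [this]
    ring
  simp_rw [h]
  rw [intervalIntegral.integral_finsetSum
    fun k _ => Continuous.intervalIntegrable (by fun_prop) _ _, Finset.mul_sum]
  refine Finset.sum_congr rfl fun k _ => ?_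
  rw [intervalIntegral.integral_finsetSum
    fun l _ => Continuous.intervalIntegrable (by fun_prop) _ _, Finset.mul_sum]
  refine Finset.sum_congr rfl fun l _ => ?_
  rw [intervalIntegral.integral_const_mul, integral_exp_int_mul_I]
  split_ifs <;> ring

theorem integral_one_add_pow_mul_one_add_pow_zero (z : ℂ) (M : ℕ) :
    ∫ θ in (0:ℝ)..(2 * π), (1 + z * cexp (θ * I)) ^ M * (1 + z * cexp (-θ * I)) ^ M =
    2 * π * ∑ k ∈ Finset.range (M + 1), (M.choose k : ℂ) ^ 2 * z ^ (2 * k) := by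
  have := integral_one_add_pow_mul_one_add_pow z M 0
  simp only [Int.cast_zero, zero_mul, Complex.exp_zero, mul_one] at this
  rw [this]
  congr 1
  refine Finset.sum_congr rfl fun k hk => ?_
  rw [Finset.sum_eq_single_of_mem k hk fun l _ hl => if_neg (by omega), if_pos (by simp)]
  ring

theorem integral_one_add_pow_mul_one_add_pow_one (z : ℂ) (M : ℕ) :
    ∫ θ in (0:ℝ)..(2 * π), (1 + z * cexp (θ * I)) ^ M * (1 + z * cexp (-θ * I)) ^ M *
      cexp (θ * I) =
    2 * π * ∑ k ∈ Finset.range (M + 1),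
      (M.choose k : ℂ) * M.choose (k + 1) * z ^ (2 * k + 1) := by
  have := integral_one_add_pow_mul_one_add_pow z M 1
  simp only [Int.cast_one, one_mul, mul_comm I] at this
  rw [this]
  congr 1
  refine Finset.sum_congr rfl fun k hk => ?_
  rw [Finset.sum_eq_single (k + 1) (fun l _ hl => if_neg (by omega))
    (fun h => by
      rw [Finset.mem_range] at h
      simp [Nat.choose_eq_zero_of_lt (show M < k + 1 by omega)]), if_pos (by simp)]
  ring

theorem integral_one_add_pow_mul_one_add_pow_neg_one (z : ℂ) (M : ℕ) :
    ∫ θ in (0:ℝ)..(2 * π), (1 + z * cexp (θ * I)) ^ M * (1 + z * cexp (-θ * I)) ^ M *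
      cexp (-θ * I) =
    2 * π * ∑ k ∈ Finset.range (M + 1),
      (M.choose k : ℂ) * M.choose (k + 1) * z ^ (2 * k + 1) := by
  have := integral_one_add_pow_mul_one_add_pow z M (-1)
  simp only [Int.cast_neg, Int.cast_one, neg_mul, one_mul, mul_comm I] at this
  simp only [neg_mul]
  rw [this, Finset.sum_comm]
  congr 1
  refine Finset.sum_congr rfl fun k hk => ?_
  rw [Finset.sum_eq_single (k + 1) (fun l _ hl => if_neg (by omega))
    (fun h => by
      rw [Finset.mem_range] at h
      simp [Nat.choose_eq_zero_of_lt (show M < k + 1 by omega)]), if_pos (by simp)]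
  ring

theorem hasSum_besselI_zero (t : ℝ) (ht : 0 ≤ t) :
    HasSum (fun k : ℕ => t ^ (2 * k) / (k.factorial : ℝ) ^ 2) (besselI 0 (2 * t)) := by
  have hexp (w : ℂ) : HasSum (fun l : ℕ => w ^ l / l.factorial) (cexp w) := by
    rw [Complex.exp_eq_exp_ℂ]
    exact NormedSpace.expSeries_div_hasSum_exp w
  have hnorm (k : ℤ) (θ : ℝ) : ‖cexp ((k : ℂ) * I * θ)‖ = 1 := by
    rw [show (k : ℂ) * I * θ = ((k * θ : ℝ) : ℂ) * I by push_cast; ring, norm_exp_ofReal_mul_I]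
  have hin (k : ℕ) : ∫ θ in (0:ℝ)..(2 * π), cexp (((k : ℤ) : ℂ) * I * θ) * cexp (t * cexp (-θ * I))
      = 2 * π * ((t : ℂ) ^ k / k.factorial) := by
    have h : HasSum
        (fun l : ℕ => ∫ θ in (0:ℝ)..(2 * π), (t : ℂ) ^ l / l.factorial *
          cexp ((((k : ℤ) - l : ℤ) : ℂ) * I * θ))
        (∫ θ in (0:ℝ)..(2 * π), cexp (((k : ℤ) : ℂ) * I * θ) * cexp (t * cexp (-θ * I))) := by
      refine intervalIntegral.hasSum_integral_of_dominated_convergence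
        (fun l _ => t ^ l / l.factorial) (fun l => by fun_prop) ?_ ?_ ?_ ?_
      · intro l
        refine ae_of_all _ fun θ _ => ?_
        rw [norm_mul, hnorm]
        simp [abs_of_nonneg ht]
      · exact ae_of_all _ fun θ _ => Real.summable_pow_div_factorial t
      · simp
      · refine ae_of_all _ fun θ _ => HasSum.congr_fun
          ((hexp (t * cexp (-θ * I))).mul_left (cexp (((k : ℤ) : ℂ) * I * θ))) fun l => ?_
        rw [mul_pow, ← Complex.exp_nat_mul, mul_div_right_comm, mul_left_comm, ← Complex.exp_add]
        push_cast
        ring_nf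
    simp_rw [intervalIntegral.integral_const_mul, integral_exp_int_mul_I] at h
    refine h.unique (HasSum.congr_fun
      (hasSum_ite_eq k (2 * π * ((t : ℂ) ^ k / k.factorial))) fun l => ?_)
    by_cases hl : l = k
    · subst hl
      simp
      ring
    · rw [if_neg (by omega), if_neg hl, mul_zero]
  have hout : HasSum
      (fun k : ℕ => ∫ θ in (0:ℝ)..(2 * π), (t : ℂ) ^ k / k.factorial *
        (cexp (((k : ℤ) : ℂ) * I * θ) * cexp (t * cexp (-θ * I))))
      (∫ θ in (0:ℝ)..(2 * π), cexp (t * cexp (θ * I)) * cexp (t * cexp (-θ * I))) := by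
    refine intervalIntegral.hasSum_integral_of_dominated_convergence
      (fun l _ => t ^ l / l.factorial * rexp t) (fun l => by fun_prop) ?_ ?_ ?_ ?_
    · intro l
      refine ae_of_all _ fun θ _ => ?_
      rw [norm_mul, norm_mul, hnorm, one_mul]
      refine mul_le_mul (by simp [abs_of_nonneg ht]) ?_ (norm_nonneg _) (by positivity)
      refine (norm_exp_le_exp_norm _).trans (Real.exp_le_exp.2 ?_)
      have := hnorm (-1) θ
      rw [show ((-1 : ℤ) : ℂ) * I * θ = -θ * I by push_cast; ring] at this
      rw [norm_mul, this]
      simp [abs_of_nonneg ht]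
    · exact ae_of_all _ fun θ _ => (Real.summable_pow_div_factorial t).mul_right _
    · simp
    · refine ae_of_all _ fun θ _ => HasSum.congr_fun
        ((hexp (t * cexp (θ * I))).mul_right (cexp (t * cexp (-θ * I)))) fun l => ?_
      rw [mul_pow, ← Complex.exp_nat_mul, ← mul_assoc, mul_div_right_comm]
      push_cast
      ring_nf
  simp_rw [intervalIntegral.integral_const_mul, hin] at hout
  have hlhs : (1 / (2 * π) : ℂ) *
      (∫ θ in (0:ℝ)..(2 * π), cexp (t * cexp (θ * I)) * cexp (t * cexp (-θ * I))) =
      ((besselI 0 (2 * t) : ℝ) : ℂ) := by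
    rw [besselI]
    push_cast
    rw [← intervalIntegral.integral_ofReal]
    congr 1
    refine intervalIntegral.integral_congr fun θ _ => ?_
    push_cast
    rw [zero_mul, Complex.cos_zero, mul_one]
    rw [← Complex.exp_add, Complex.cos]
    ring_nf
  have h := hout.mul_left (1 / (2 * π) : ℂ)
  rw [hlhs] at h
  rw [← Complex.hasSum_ofReal]
  refine h.congr_fun fun k => ?_
  have : (π : ℂ) ≠ 0 := by exact_mod_cast Real.pi_ne_zero
  push_cast
  field_simp
  ring

theorem integral_one_add_pow_mul_trig (z A B C : ℂ) (M : ℕ) :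
    ∫ θ in (0:ℝ)..(2 * π), (1 + z * cexp (θ * I)) ^ M * (1 + z * cexp (-θ * I)) ^ M *
      (A + B * cexp (θ * I) + C * cexp (-θ * I)) =
    2 * π * ∑ k ∈ Finset.range (M + 1), (A * ((M.choose k : ℂ) ^ 2 * z ^ (2 * k)) +
      (B + C) * ((M.choose k : ℂ) * M.choose (k + 1) * z ^ (2 * k + 1))) := by
  have h (θ : ℝ) : (1 + z * cexp (θ * I)) ^ M * (1 + z * cexp (-θ * I)) ^ M *
      (A + B * cexp (θ * I) + C * cexp (-θ * I)) =
      A * ((1 + z * cexp (θ * I)) ^ M * (1 + z * cexp (-θ * I)) ^ M) +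
      B * ((1 + z * cexp (θ * I)) ^ M * (1 + z * cexp (-θ * I)) ^ M * cexp (θ * I)) +
      C * ((1 + z * cexp (θ * I)) ^ M * (1 + z * cexp (-θ * I)) ^ M * cexp (-θ * I)) := by ring
  simp_rw [h]
  rw [intervalIntegral.integral_add (Continuous.intervalIntegrable (by fun_prop) _ _)
      (Continuous.intervalIntegrable (by fun_prop) _ _),
    intervalIntegral.integral_add (Continuous.intervalIntegrable (by fun_prop) _ _)
      (Continuous.intervalIntegrable (by fun_prop) _ _),
    intervalIntegral.integral_const_mul, intervalIntegral.integral_const_mul,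
    intervalIntegral.integral_const_mul, integral_one_add_pow_mul_one_add_pow_zero,
    integral_one_add_pow_mul_one_add_pow_one, integral_one_add_pow_mul_one_add_pow_neg_one,
    Finset.sum_add_distrib, ← Finset.mul_sum, ← Finset.mul_sum]
  ring

theorem Ffun_one_or_two_eq_sum (t : ℝ) (M : ℕ) {j : Fin 3} (hj : j = 1 ∨ j = 2) {R₁ R₂ : ℝ}
    (h₁ : 0 < R₁) (h₂ : 0 < R₂) :
    Ffun t (M + 2) j R₁ R₂ = (∑ k ∈ Finset.range (M + 1),
      ((t * (((M + 2 : ℕ) : ℝ) / ((M + 2 : ℕ) - 1)) * (R₁ * R₂) +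
          t ^ 3 / (((M + 2 : ℕ) : ℝ) ^ 2 * ((M + 2 : ℕ) - 1))) *
        ((M.choose k : ℝ) ^ 2 * (t / (M + 2 : ℕ)) ^ (2 * k)) +
      (2 * (t ^ 2 / (((M + 2 : ℕ) : ℝ) - 1)) - t ^ 2 / (M + 2 : ℕ)) *
        (M.choose k * M.choose (k + 1) * (t / (M + 2 : ℕ)) ^ (2 * k + 1))) /
      (R₁ * R₂) ^ (k + 2) : ℝ) := by
  set s := √(R₁ * R₂) with hs
  have hs0 : 0 < s := Real.sqrt_pos.2 (by positivity)
  have hs2 : R₁ * R₂ = s ^ 2 := (Real.sq_sqrt (by positivity)).symm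
  set N : ℕ := M + 2
  have key : ∫ θ in (0:ℝ)..(2 * π),
      (1 + (t : ℂ) * cexp (θ * I) / ((N : ℂ) * (s : ℝ))) ^ (N - 2) *
      (1 + (t : ℂ) * cexp (-θ * I) / ((N : ℂ) * (s : ℝ))) ^ (N - 2) * Ufun t N j R₁ R₂ θ =
      2 * π * ∑ k ∈ Finset.range (M + 1),
        (((t * ((N : ℝ) / ((N : ℝ) - 1)) * (R₁ * R₂) +
          t ^ 3 / ((N : ℝ) ^ 2 * ((N : ℝ) - 1)) : ℝ) : ℂ) *
        ((M.choose k : ℂ) ^ 2 * (t / (N * s) : ℂ) ^ (2 * k)) +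
      (((2 * (t ^ 2 / ((N : ℝ) - 1)) - t ^ 2 / N) * s : ℝ) : ℂ) *
        (M.choose k * M.choose (k + 1) * (t / (N * s) : ℂ) ^ (2 * k + 1))) := by
    have hz (w : ℂ) : 1 + (t : ℂ) * w / (N * s) = 1 + (t / (N * s) : ℂ) * w := by ring
    simp_rw [hz, show N - 2 = M from rfl]
    rcases hj with rfl | rfl
    · convert integral_one_add_pow_mul_trig (t / (N * s) : ℂ)
        ((t * ((N : ℝ) / ((N : ℝ) - 1)) * (R₁ * R₂) +
          t ^ 3 / ((N : ℝ) ^ 2 * ((N : ℝ) - 1)) : ℝ) : ℂ)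
        ((t ^ 2 / ((N : ℝ) - 1) * s - t ^ 2 / N * s : ℝ) : ℂ)
        ((t ^ 2 / ((N : ℝ) - 1) * s : ℝ) : ℂ) M using 1
      · refine intervalIntegral.integral_congr fun θ _ => ?_
        simp only [Ufun, Matrix.cons_val_one, Matrix.cons_val_zero, U1, ← hs]
        congr 1
        push_cast
        ring
      · congr 1
        refine Finset.sum_congr rfl fun k _ => ?_
        push_cast
        ring
    · convert integral_one_add_pow_mul_trig (t / (N * s) : ℂ)
        ((t * ((N : ℝ) / ((N : ℝ) - 1)) * (R₁ * R₂) +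
          t ^ 3 / ((N : ℝ) ^ 2 * ((N : ℝ) - 1)) : ℝ) : ℂ)
        ((t ^ 2 / ((N : ℝ) - 1) * s : ℝ) : ℂ)
        ((t ^ 2 / ((N : ℝ) - 1) * s - t ^ 2 / N * s : ℝ) : ℂ) M using 1
      · refine intervalIntegral.integral_congr fun θ _ => ?_
        simp only [Ufun, Matrix.cons_val, U2, ← hs]
        congr 1
        push_cast
        ring
      · congr 1
        refine Finset.sum_congr rfl fun k _ => ?_
        push_cast
        ring
  rw [Ffun, ← hs, key]
  have hπ : (π : ℂ) ≠ 0 := by exact_mod_cast Real.pi_ne_zero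
  push_cast
  rw [Finset.mul_sum, Finset.mul_sum]
  refine Finset.sum_congr rfl fun k _ => ?_
  have hs2c : (R₁ : ℂ) * R₂ = (s : ℂ) ^ 2 := by exact_mod_cast hs2
  have hsc : (s : ℂ) ≠ 0 := by exact_mod_cast hs0.ne'
  rw [hs2c, ← div_div (t : ℂ), div_pow _ (s : ℂ), div_pow _ (s : ℂ)]
  generalize (t : ℂ) / N = τ
  generalize (t : ℂ) * (N / (N - 1)) * s ^ 2 + t ^ 3 / (N ^ 2 * (N - 1)) = A
  generalize (2 * ((t : ℂ) ^ 2 / (N - 1)) - t ^ 2 / N) = B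
  field_simp
  ring

theorem integrableOn_pow_mul_exp_neg_mul_sub_one (p : ℕ) {r : ℝ} (hr : 0 < r) :
    IntegrableOn (fun x : ℝ => x ^ p * rexp (-r * (x - 1))) (Set.Ioi 0) := by
  have h := (integrableOn_rpow_mul_exp_neg_mul_rpow (p := 1) (s := p) (b := r)
    (by linarith [p.cast_nonneg (α := ℝ)]) one_pos hr).mul_const (rexp r)
  refine h.congr (ae_of_all _ fun x => ?_)
  simp only [rpow_natCast, rpow_one]
  rw [mul_assoc, ← Real.exp_add]
  ring_nf

theorem integral_pow_mul_exp_neg_mul_sub_one (p : ℕ) {r : ℝ} (hr : 0 < r) :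
    ∫ x in Set.Ioi (0:ℝ), x ^ p * rexp (-r * (x - 1)) = rexp r * p.factorial / r ^ (p + 1) := by
  have h := Real.integral_rpow_mul_exp_neg_mul_Ioi (a := p + 1) (by positivity) hr
  have hx (x : ℝ) : x ^ p * rexp (-r * (x - 1)) =
      rexp r * (x ^ ((p : ℝ) + 1 - 1) * rexp (-(r * x))) := by
    rw [add_sub_cancel_right, rpow_natCast, mul_left_comm, ← Real.exp_add]
    ring_nf
  simp_rw [hx]
  rw [integral_const_mul, h, Real.Gamma_nat_eq_factorial, ← Nat.cast_add_one, rpow_natCast,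
    one_div_pow]
  field_simp

theorem Ifun_one_or_two_eq_sum (t : ℝ) (M : ℕ) {j : Fin 3} (hj : j = 1 ∨ j = 2) :
    Ifun t (M + 2) j = (((M + 2 : ℕ) : ℝ) / (2 * π) *
      (rexp (M + 2 : ℕ) * M.factorial / ((M + 2 : ℕ) : ℝ) ^ (M + 1)) ^ 2 *
      ∑ k ∈ Finset.range (M + 1), t ^ (2 * k) / (k.factorial : ℝ) ^ 2 *
        (t * (((M + 2 : ℕ) : ℝ) / ((M + 2 : ℕ) - 1)) * ((M - k + 1) / (M + 2 : ℕ)) ^ 2 +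
          t ^ 3 / (((M + 2 : ℕ) : ℝ) ^ 2 * ((M + 2 : ℕ) - 1)) +
          (2 * (t ^ 2 / (((M + 2 : ℕ) : ℝ) - 1)) - t ^ 2 / (M + 2 : ℕ)) *
            (t / (M + 2 : ℕ) * ((M - k) / (k + 1)))) : ℝ) := by
  have hN : (0 : ℝ) < (M + 2 : ℕ) := by positivity
  set a : ℝ := t * (((M + 2 : ℕ) : ℝ) / ((M + 2 : ℕ) - 1)) with ha
  set d : ℝ := t ^ 3 / (((M + 2 : ℕ) : ℝ) ^ 2 * ((M + 2 : ℕ) - 1)) with hd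
  set e : ℝ := 2 * (t ^ 2 / (((M + 2 : ℕ) : ℝ) - 1)) - t ^ 2 / (M + 2 : ℕ) with he
  set w : ℕ → ℝ → ℝ := fun p x => x ^ p * rexp (-((M + 2 : ℕ) : ℝ) * (x - 1)) with hw
  set τ : ℝ := t / (M + 2 : ℕ) with hτ
  have hint (p : ℕ) : IntegrableOn (fun R : ℝ × ℝ => w p R.1 * w p R.2)
      (Set.Ioi 0 ×ˢ Set.Ioi 0) := by
    rw [IntegrableOn, Measure.volume_eq_prod, ← Measure.prod_restrict]
    exact Integrable.mul_prod (integrableOn_pow_mul_exp_neg_mul_sub_one p hN)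
      (integrableOn_pow_mul_exp_neg_mul_sub_one p hN)
  have hval (p : ℕ) : ∫ R in Set.Ioi (0:ℝ) ×ˢ Set.Ioi (0:ℝ), w p R.1 * w p R.2 =
      (rexp (M + 2 : ℕ) * p.factorial / ((M + 2 : ℕ) : ℝ) ^ (p + 1)) ^ 2 := by
    rw [Measure.volume_eq_prod, setIntegral_prod_mul (w p) (w p),
      integral_pow_mul_exp_neg_mul_sub_one p hN, sq]
  have hweight {x : ℝ} (hx : 0 < x) : rexp (-((M + 2 : ℕ) : ℝ) * (x - 1 - Real.log x)) =
      x ^ (M + 2) * rexp (-((M + 2 : ℕ) : ℝ) * (x - 1)) := by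
    rw [show -((M + 2 : ℕ) : ℝ) * (x - 1 - Real.log x) =
      (M + 2 : ℕ) * Real.log x + -((M + 2 : ℕ) : ℝ) * (x - 1) by ring, Real.exp_add,
      Real.exp_nat_mul, Real.exp_log hx]
  have hF : ∀ R ∈ Set.Ioi (0:ℝ) ×ˢ Set.Ioi (0:ℝ),
      ((rexp (-((M + 2 : ℕ) : ℝ) * (R.1 - 1 - Real.log R.1)) *
        rexp (-((M + 2 : ℕ) : ℝ) * (R.2 - 1 - Real.log R.2)) : ℝ) : ℂ) *
          Ffun t (M + 2) j R.1 R.2 =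
      ((∑ k ∈ Finset.range (M + 1),
        (a * ((M.choose k : ℝ) ^ 2 * τ ^ (2 * k)) * (w (M - k + 1) R.1 * w (M - k + 1) R.2) +
        (d * ((M.choose k : ℝ) ^ 2 * τ ^ (2 * k)) +
          e * (M.choose k * M.choose (k + 1) * τ ^ (2 * k + 1))) *
          (w (M - k) R.1 * w (M - k) R.2)) : ℝ) : ℂ) := by
    rintro ⟨x, y⟩ ⟨hx, hy⟩
    simp only [Set.mem_Ioi] at hx hy
    rw [Ffun_one_or_two_eq_sum t M hj hx hy, ← Complex.ofReal_mul, hweight hx, hweight hy,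
      Finset.mul_sum]
    congr 1
    refine Finset.sum_congr rfl fun k hk => ?_
    obtain ⟨q, hq⟩ := Nat.exists_eq_add_of_le (Finset.mem_range_succ_iff.1 hk)
    have hp : M - k = q := by omega
    have hpow (x : ℝ) : x ^ (M + 2) = x ^ q * x ^ (k + 2) := by
      rw [← pow_add]
      congr 1
      omega
    rw [← ha, ← hd, ← he, ← hτ, hp, hpow x, hpow y, mul_pow x y (k + 2)]
    simp only [hw]
    field_simp
    ring
  rw [Ifun, setIntegral_congr_fun (measurableSet_Ioi.prod measurableSet_Ioi) hF,
    integral_complex_ofReal, ← Complex.ofReal_mul]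
  congr 1
  rw [integral_finsetSum]
  swap
  · exact fun k _ => ((hint _).const_mul _).add ((hint _).const_mul _)
  rw [Finset.mul_sum, Finset.mul_sum]
  refine Finset.sum_congr rfl fun k hk => ?_
  rw [integral_add ((hint _).const_mul _) ((hint _).const_mul _), integral_const_mul,
    integral_const_mul, hval, hval]
  obtain ⟨q, hq⟩ := Nat.exists_eq_add_of_le (Finset.mem_range_succ_iff.1 hk)
  have hp : M - k = q := by omega
  have hpr : (M : ℝ) - k = q := by rw [hq]; push_cast; ring
  have hchoose : (M.factorial : ℝ) = M.choose k * k.factorial * q.factorial := by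
    rw [← hp]; exact_mod_cast (Nat.choose_mul_factorial_mul_factorial (by omega)).symm
  have hsucc : (M.choose (k + 1) : ℝ) = M.choose k * q / (k + 1) := by
    rw [eq_div_iff (by positivity), ← hp]
    exact_mod_cast Nat.choose_succ_right_eq M k
  have hpow :
      ((M + 2 : ℕ) : ℝ) ^ (M + 1) = ((M + 2 : ℕ) : ℝ) ^ k * ((M + 2 : ℕ) : ℝ) ^ (q + 1) := by
    rw [← pow_add]
    congr 1
    omega
  rw [hp, hpr, hpow, hchoose, hsucc, Nat.factorial_succ, hτ, pow_succ _ (q + 1)]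
  push_cast at hN ⊢
  generalize (M : ℝ) + 2 = n at *
  generalize rexp n = E
  have : (k.factorial : ℝ) ≠ 0 := by positivity
  rw [div_pow t, div_pow t]
  field_simp
  ring

theorem tendsto_stirling_prefactor :
    Tendsto (fun M : ℕ => ((M + 2 : ℕ) : ℝ) / (2 * π) *
      (rexp (M + 2 : ℕ) * M.factorial / ((M + 2 : ℕ) : ℝ) ^ (M + 1)) ^ 2) atTop (nhds 1) := by
  have h1 : Tendsto (fun M : ℕ => 1 + 1 / ((M : ℝ) + 1)) atTop (nhds (1 + 0)) :=
    tendsto_one_div_add_atTop_nhds_zero_nat.const_add 1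
  have h2 := ((tendsto_add_atTop_iff_nat 2).2 Stirling.tendsto_stirlingSeq_sqrt_pi).pow 2
  have h := (h2.div_const π).mul (h1.pow 2)
  rw [Real.sq_sqrt Real.pi_pos.le, div_self Real.pi_ne_zero, add_zero, one_pow, one_mul] at h
  refine h.congr fun M => ?_
  rw [Stirling.stirlingSeq, div_pow _ (_ * _), mul_pow √_, Real.sq_sqrt (by positivity),
    div_pow _ (rexp 1), ← Real.exp_nat_mul, mul_one, Nat.factorial_succ, Nat.factorial_succ,
    pow_succ _ (M + 1)]
  push_cast
  have : (M : ℝ) + 1 ≠ 0 := by positivity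
  have : (M : ℝ) + 2 ≠ 0 := by positivity
  field_simp
  ring

theorem tendsto_sum_bessel_terms {t : ℝ} (ht : 0 < t) :
    Tendsto (fun M : ℕ => ∑ k ∈ Finset.range (M + 1), t ^ (2 * k) / (k.factorial : ℝ) ^ 2 *
        (t * (((M + 2 : ℕ) : ℝ) / ((M + 2 : ℕ) - 1)) * ((M - k + 1) / (M + 2 : ℕ)) ^ 2 +
          t ^ 3 / (((M + 2 : ℕ) : ℝ) ^ 2 * ((M + 2 : ℕ) - 1)) +
          (2 * (t ^ 2 / (((M + 2 : ℕ) : ℝ) - 1)) - t ^ 2 / (M + 2 : ℕ)) *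
            (t / (M + 2 : ℕ) * ((M - k) / (k + 1))))) atTop
      (nhds (t * besselI 0 (2 * t))) := by
  have hsum := hasSum_besselI_zero t ht.le
  set u : ℕ → ℝ := fun M => 1 / ((M : ℝ) + 1) with hu
  set v : ℕ → ℝ := fun M => 1 / ((M : ℝ) + 2) with hv
  have hu0 : Tendsto u atTop (nhds 0) := tendsto_one_div_add_atTop_nhds_zero_nat
  have hv0 : Tendsto v atTop (nhds 0) := by
    refine ((tendsto_add_atTop_iff_nat 1).2 hu0).congr fun M => ?_
    simp only [hu, hv]
    push_cast
    ring
  set g : ℕ → ℕ → ℝ := fun M k => t ^ (2 * k) / (k.factorial : ℝ) ^ 2 *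
    (t * (1 + u M) * (1 - (k + 1) * v M) ^ 2 + t ^ 3 * (v M ^ 2 * u M) +
      (2 * t ^ 2 * u M - t ^ 2 * v M) * (t * (1 - (k + 2) * v M) / (k + 1))) with hg
  have hlim (k : ℕ) : Tendsto (fun M => g M k) atTop
      (nhds (t * (t ^ (2 * k) / (k.factorial : ℝ) ^ 2))) := by
    have hux := (hu0.const_add 1).const_mul t
    have hvx := (((hv0.const_mul (k + 1 : ℝ)).const_sub 1).pow 2)
    have hvy := (((hv0.const_mul (k + 2 : ℝ)).const_sub 1).const_mul t).div_const (k + 1 : ℝ)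
    have hd := ((hv0.pow 2).mul hu0).const_mul (t ^ 3)
    have he := (hu0.const_mul (2 * t ^ 2)).sub (hv0.const_mul (t ^ 2))
    have := (((hux.mul hvx).add hd).add (he.mul hvy)).const_mul
      (t ^ (2 * k) / (k.factorial : ℝ) ^ 2)
    simp only [mul_zero, zero_mul, add_zero, sub_zero, one_pow, mul_one] at this
    rwa [mul_comm t]
  have htannery := tendsto_tsum_of_dominated_convergence (𝓕 := atTop)
    (f := fun M k => if k ∈ Finset.range (M + 1) then g M k else 0)
    (g := fun k => t * (t ^ (2 * k) / (k.factorial : ℝ) ^ 2))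
    (bound := fun k => t ^ (2 * k) / (k.factorial : ℝ) ^ 2 * (2 * t + t ^ 3 + 2 * t ^ 2 * t))
    (hsum.summable.mul_right _)
    (fun k => (hlim k).congr' (by
      filter_upwards [eventually_ge_atTop k] with M hM
      rw [if_pos (Finset.mem_range_succ_iff.2 hM)]))
    (Eventually.of_forall fun M k => by
      split_ifs with hk
      · have hkM : (k : ℝ) ≤ M := by exact_mod_cast Finset.mem_range_succ_iff.1 hk
        have hu1 : u M ≤ 1 := by
          simp only [hu]
          rw [div_le_one (by positivity)]
          linarith [M.cast_nonneg (α := ℝ)]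
        have hvu : v M ≤ u M := one_div_le_one_div_of_le (by positivity) (by linarith)
        have hvp : 0 < v M := by positivity
        have hkv : ((k : ℝ) + 2) * v M ≤ 1 := by
          simp only [hv]
          rw [mul_one_div, div_le_one (by positivity)]
          linarith
        have hk0 : (0 : ℝ) ≤ k := k.cast_nonneg
        have hx : 0 ≤ 1 - ((k : ℝ) + 1) * v M := by nlinarith
        have hx' : 1 - ((k : ℝ) + 1) * v M ≤ 1 := by nlinarith
        have hy : 0 ≤ 1 - ((k : ℝ) + 2) * v M := by linarith
        have hy' : t * (1 - ((k : ℝ) + 2) * v M) / (k + 1) ≤ t := by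
          rw [div_le_iff₀ (by positivity)]
          have : 0 ≤ ((k : ℝ) + 2) * v M := by positivity
          nlinarith [mul_nonneg ht.le this, mul_nonneg ht.le hk0]
        have hup : 0 < u M := by positivity
        have he : 0 ≤ 2 * t ^ 2 * u M - t ^ 2 * v M := by
          nlinarith [mul_le_mul_of_nonneg_left hvu (sq_nonneg t), mul_nonneg (sq_nonneg t) hup.le]
        have he' : 2 * t ^ 2 * u M - t ^ 2 * v M ≤ 2 * t ^ 2 := by
          nlinarith [mul_le_mul_of_nonneg_left hu1 (sq_nonneg t), mul_nonneg (sq_nonneg t) hvp.le]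
        rw [Real.norm_of_nonneg (by simp only [hg]; positivity)]
        refine mul_le_mul_of_nonneg_left ?_ (by positivity)
        refine add_le_add (add_le_add ?_ ?_) (mul_le_mul he' hy' (by positivity) (by positivity))
        · calc t * (1 + u M) * (1 - (k + 1) * v M) ^ 2 ≤ t * (1 + 1) * 1 ^ 2 := by gcongr
            _ = 2 * t := by ring
        · have : v M ^ 2 * u M ≤ 1 ^ 2 * 1 := by
            gcongr
            exact hvu.trans hu1
          nlinarith [pow_pos ht 3]
      · rw [norm_zero]
        positivity)
  rw [tsum_mul_left, hsum.tsum_eq] at htannery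
  refine htannery.congr fun M => ?_
  rw [tsum_eq_sum (s := Finset.range (M + 1)) fun k hk => if_neg hk]
  refine Finset.sum_congr rfl fun k hk => ?_
  rw [if_pos hk]
  simp only [hg, hu, hv]
  have h1 : ((M + 2 : ℕ) : ℝ) - 1 = M + 1 := by push_cast; ring
  rw [h1]
  push_cast
  congr 1
  field_simp
  ring

theorem tendsto_Ifun_one_or_two {t : ℝ} (ht : 0 < t) {j : Fin 3} (hj : j = 1 ∨ j = 2) :
    Tendsto (fun N : ℕ => Ifun t N j) atTop (nhds (((t * besselI 0 (2 * t) : ℝ)) : ℂ)) := by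
  rw [← tendsto_add_atTop_iff_nat 2]
  simp_rw [Ifun_one_or_two_eq_sum t _ hj]
  have h := tendsto_stirling_prefactor.mul (tendsto_sum_bessel_terms ht)
  rw [one_mul] at h
  exact (Complex.continuous_ofReal.tendsto _).comp h

/-- For fixed `t > 0`, `I_{1,N}(t)` and `I_{2,N}(t)` both converge to `t · I₀(2t)` as `N → ∞`. -/
theorem I1N_I2N_tendsto (t : ℝ) (ht : 0 < t) :
    Tendsto (fun N : ℕ => Ifun t N 1) atTop (nhds (((t * besselI 0 (2 * t) : ℝ)) : ℂ)) ∧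
    Tendsto (fun N : ℕ => Ifun t N 2) atTop (nhds (((t * besselI 0 (2 * t) : ℝ)) : ℂ)) :=
  ⟨tendsto_Ifun_one_or_two ht (.inl rfl), tendsto_Ifun_one_or_two ht (.inr rfl)⟩
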